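/- arXiv:1107.0951 — 3 statements merged into one kernel-verified Lean document; each statement's English description precedes it below -/
import Mathlib

section
/- Let m : (A⊗V)⊗(A⊗V) → A⊗V be an associative k-linear multiplication on A⊗V admitting a two-sided identity element and satisfying m((a⊗1_V)⊗(b⊗v)) = ab⊗v for all a,b ∈ A and v ∈ V. Then the identity element is 1_A⊗1_V and, defining χ : V⊗A → A⊗V by χ(v⊗a) := m((1_A⊗v)⊗(a⊗1_V)) and F : V⊗V → A⊗V by F(v⊗w) := m((1_A⊗v)⊗(1_A⊗w)), one has m = (μ_A⊗id_V)∘(μ_A⊗F)∘(id_A⊗χ⊗id_V); consequently χ is a twisting map and F is a normal cocycle that satisfies the twisted module condition. -/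
/-!
Converse of Brzeziński's theorem: any associative unital multiplication `m` on `A ⊗ V`
with `m((a⊗1_V)⊗(b⊗v)) = ab⊗v` has identity `1_A⊗1_V`, equals `smashMul χ F` for the
induced `χ` and `F`, and `χ` is a twisting map while `F` is a normal cocycle satisfying
the twisted module condition.
-/

open scoped TensorProduct

universe u

variable {k : Type u} [Field k]
variable {A : Type u} [Ring A] [Algebra k A]
variable {V : Type u} [AddCommGroup V] [Module k V]

/-- The multiplication `μ_{A#V} := (μ_A⊗id_V)∘(μ_A⊗F)∘(id_A⊗χ⊗id_V)` of `A # V`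
(with the implicit associativity identifications of tensor factors made explicit). -/
noncomputable def smashMul (χ : V ⊗[k] A →ₗ[k] A ⊗[k] V) (F : V ⊗[k] V →ₗ[k] A ⊗[k] V) :
    (A ⊗[k] V) ⊗[k] (A ⊗[k] V) →ₗ[k] A ⊗[k] V :=
  TensorProduct.map (LinearMap.mul' k A) (LinearMap.id : V →ₗ[k] V)
    ∘ₗ (TensorProduct.assoc k A A V).symm.toLinearMap
    ∘ₗ TensorProduct.map (LinearMap.mul' k A) F
    ∘ₗ (TensorProduct.assoc k A A (V ⊗[k] V)).symm.toLinearMap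
    ∘ₗ LinearMap.lTensor A (TensorProduct.assoc k A V V).toLinearMap
    ∘ₗ LinearMap.lTensor A (LinearMap.rTensor V χ)
    ∘ₗ LinearMap.lTensor A (TensorProduct.assoc k V A V).symm.toLinearMap
    ∘ₗ (TensorProduct.assoc k A V (A ⊗[k] V)).toLinearMap

/-- `χ` is a twisting map: `χ(v⊗1_A) = 1_A⊗v`, `χ(1_V⊗a) = a⊗1_V` and
`χ∘(id_V⊗μ_A) = (μ_A⊗id_V)∘(id_A⊗χ)∘(χ⊗id_A)` (here `e` is the distinguished element `1_V`). -/
def IsTwistingMap (χ : V ⊗[k] A →ₗ[k] A ⊗[k] V) (e : V) : Prop :=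
  (∀ v : V, χ (v ⊗ₜ[k] (1 : A)) = (1 : A) ⊗ₜ[k] v) ∧
  (∀ a : A, χ (e ⊗ₜ[k] a) = a ⊗ₜ[k] e) ∧
  (χ ∘ₗ LinearMap.lTensor V (LinearMap.mul' k A)
    = TensorProduct.map (LinearMap.mul' k A) (LinearMap.id : V →ₗ[k] V)
        ∘ₗ (TensorProduct.assoc k A A V).symm.toLinearMap
        ∘ₗ LinearMap.lTensor A χ
        ∘ₗ (TensorProduct.assoc k A V A).toLinearMap
        ∘ₗ LinearMap.rTensor A χ
        ∘ₗ (TensorProduct.assoc k V A A).symm.toLinearMap)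

/-- `F` is normal: `F(1_V⊗v) = F(v⊗1_V) = 1_A⊗v`. -/
def IsNormal (F : V ⊗[k] V →ₗ[k] A ⊗[k] V) (e : V) : Prop :=
  (∀ v : V, F (e ⊗ₜ[k] v) = (1 : A) ⊗ₜ[k] v) ∧ (∀ v : V, F (v ⊗ₜ[k] e) = (1 : A) ⊗ₜ[k] v)

/-- The cocycle condition
`(μ_A⊗id_V)∘(id_A⊗F)∘(χ⊗id_V)∘(id_V⊗F) = (μ_A⊗id_V)∘(id_A⊗F)∘(F⊗id_V)`
as maps `V⊗V⊗V → A⊗V`. -/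
def IsCocycle (χ : V ⊗[k] A →ₗ[k] A ⊗[k] V) (F : V ⊗[k] V →ₗ[k] A ⊗[k] V) : Prop :=
  TensorProduct.map (LinearMap.mul' k A) (LinearMap.id : V →ₗ[k] V)
      ∘ₗ (TensorProduct.assoc k A A V).symm.toLinearMap
      ∘ₗ LinearMap.lTensor A F
      ∘ₗ (TensorProduct.assoc k A V V).toLinearMap
      ∘ₗ LinearMap.rTensor V χ
      ∘ₗ (TensorProduct.assoc k V A V).symm.toLinearMap
      ∘ₗ LinearMap.lTensor V F
    = TensorProduct.map (LinearMap.mul' k A) (LinearMap.id : V →ₗ[k] V)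
      ∘ₗ (TensorProduct.assoc k A A V).symm.toLinearMap
      ∘ₗ LinearMap.lTensor A F
      ∘ₗ (TensorProduct.assoc k A V V).toLinearMap
      ∘ₗ LinearMap.rTensor V F
      ∘ₗ (TensorProduct.assoc k V V V).symm.toLinearMap

/-- The twisted module condition
`(μ_A⊗id_V)∘(id_A⊗F)∘(χ⊗id_V)∘(id_V⊗χ) = (μ_A⊗id_V)∘(id_A⊗χ)∘(F⊗id_A)`
as maps `V⊗V⊗A → A⊗V`. -/
def SatisfiesTwistedModuleCondition (χ : V ⊗[k] A →ₗ[k] A ⊗[k] V)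
    (F : V ⊗[k] V →ₗ[k] A ⊗[k] V) : Prop :=
  TensorProduct.map (LinearMap.mul' k A) (LinearMap.id : V →ₗ[k] V)
      ∘ₗ (TensorProduct.assoc k A A V).symm.toLinearMap
      ∘ₗ LinearMap.lTensor A F
      ∘ₗ (TensorProduct.assoc k A V V).toLinearMap
      ∘ₗ LinearMap.rTensor V χ
      ∘ₗ (TensorProduct.assoc k V A V).symm.toLinearMap
      ∘ₗ LinearMap.lTensor V χ
    = TensorProduct.map (LinearMap.mul' k A) (LinearMap.id : V →ₗ[k] V)
      ∘ₗ (TensorProduct.assoc k A A V).symm.toLinearMap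
      ∘ₗ LinearMap.lTensor A χ
      ∘ₗ (TensorProduct.assoc k A V A).toLinearMap
      ∘ₗ LinearMap.rTensor A F
      ∘ₗ (TensorProduct.assoc k V V A).symm.toLinearMap


/-- The twisting map induced by a multiplication `m` on `A ⊗ V`: `χ(v⊗a) := m((1⊗v)⊗(a⊗1_V))`. -/
noncomputable def inducedTwist (m : (A ⊗[k] V) ⊗[k] (A ⊗[k] V) →ₗ[k] A ⊗[k] V) (e : V) :
    V ⊗[k] A →ₗ[k] A ⊗[k] V :=
  m ∘ₗ TensorProduct.map (TensorProduct.mk k A V 1) ((TensorProduct.mk k A V).flip e)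

/-- The cocycle induced by a multiplication `m` on `A ⊗ V`: `F(v⊗w) := m((1⊗v)⊗(1⊗w))`. -/
noncomputable def inducedCocycle (m : (A ⊗[k] V) ⊗[k] (A ⊗[k] V) →ₗ[k] A ⊗[k] V) :
    V ⊗[k] V →ₗ[k] A ⊗[k] V :=
  m ∘ₗ TensorProduct.map (TensorProduct.mk k A V 1) (TensorProduct.mk k A V 1)

lemma map_mul'_assoc_symm_tmul (a : A) (x : A ⊗[k] V) :
    TensorProduct.map (LinearMap.mul' k A) (LinearMap.id : V →ₗ[k] V)
      ((TensorProduct.assoc k A A V).symm (a ⊗ₜ[k] x)) = a • x := by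
  induction x using TensorProduct.induction_on with
  | zero => simp
  | tmul b v => simp [TensorProduct.smul_tmul']
  | add x y hx hy => rw [TensorProduct.tmul_add, map_add, map_add, hx, hy, smul_add]

lemma mul_tmul_distinguished {m : (A ⊗[k] V) ⊗[k] (A ⊗[k] V) →ₗ[k] A ⊗[k] V} {e : V}
    (hsm : ∀ (a b : A) (v : V), m ((a ⊗ₜ[k] e) ⊗ₜ[k] (b ⊗ₜ[k] v)) = (a * b) ⊗ₜ[k] v)
    (a : A) (x : A ⊗[k] V) : m ((a ⊗ₜ[k] e) ⊗ₜ[k] x) = a • x := by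
  induction x using TensorProduct.induction_on with
  | zero => simp
  | tmul b v => simp [hsm, TensorProduct.smul_tmul']
  | add x y hx hy => rw [TensorProduct.tmul_add, map_add, hx, hy, smul_add]

lemma mul_smul_left {m : (A ⊗[k] V) ⊗[k] (A ⊗[k] V) →ₗ[k] A ⊗[k] V} {e : V}
    (hassoc : ∀ x y z : A ⊗[k] V,
      m (m (x ⊗ₜ[k] y) ⊗ₜ[k] z) = m (x ⊗ₜ[k] m (y ⊗ₜ[k] z)))
    (hsm : ∀ (a b : A) (v : V), m ((a ⊗ₜ[k] e) ⊗ₜ[k] (b ⊗ₜ[k] v)) = (a * b) ⊗ₜ[k] v)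
    (a : A) (x y : A ⊗[k] V) : m ((a • x) ⊗ₜ[k] y) = a • m (x ⊗ₜ[k] y) := by
  rw [← mul_tmul_distinguished hsm, hassoc, mul_tmul_distinguished hsm]

/-- If `m` is left `A`-linear and `G (v ⊗ c) = m ((1 ⊗ v) ⊗ f c)`, then
`(μ_A⊗id)∘(id⊗G)` sends `x ⊗ c` to `m (x ⊗ f c)`. -/
lemma map_mul'_lTensor_eq_mul {W : Type u} [AddCommGroup W] [Module k W]
    {m : (A ⊗[k] V) ⊗[k] (A ⊗[k] V) →ₗ[k] A ⊗[k] V}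
    (hm : ∀ (a : A) (x y : A ⊗[k] V), m ((a • x) ⊗ₜ[k] y) = a • m (x ⊗ₜ[k] y))
    {G : V ⊗[k] W →ₗ[k] A ⊗[k] V} {f : W → A ⊗[k] V}
    (hG : ∀ v c, G (v ⊗ₜ[k] c) = m (((1 : A) ⊗ₜ[k] v) ⊗ₜ[k] f c)) (x : A ⊗[k] V) (c : W) :
    TensorProduct.map (LinearMap.mul' k A) (LinearMap.id : V →ₗ[k] V)
      ((TensorProduct.assoc k A A V).symm
        (LinearMap.lTensor A G (TensorProduct.assoc k A V W (x ⊗ₜ[k] c)))) =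
      m (x ⊗ₜ[k] f c) := by
  induction x using TensorProduct.induction_on with
  | zero => simp
  | tmul a v =>
    rw [TensorProduct.assoc_tmul, LinearMap.lTensor_tmul, map_mul'_assoc_symm_tmul, hG, ← hm,
      TensorProduct.smul_tmul', smul_eq_mul, mul_one]
  | add x y hx hy => simp only [TensorProduct.add_tmul, map_add, hx, hy]

lemma map_mul'_map_mul' (F : V ⊗[k] V →ₗ[k] A ⊗[k] V) (a : A) (x : A ⊗[k] (V ⊗[k] V)) :
    TensorProduct.map (LinearMap.mul' k A) (LinearMap.id : V →ₗ[k] V)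
      ((TensorProduct.assoc k A A V).symm
        (TensorProduct.map (LinearMap.mul' k A) F
          ((TensorProduct.assoc k A A (V ⊗[k] V)).symm (a ⊗ₜ[k] x)))) =
      a • TensorProduct.map (LinearMap.mul' k A) (LinearMap.id : V →ₗ[k] V)
        ((TensorProduct.assoc k A A V).symm (LinearMap.lTensor A F x)) := by
  induction x using TensorProduct.induction_on with
  | zero => simp
  | tmul b y => simp [map_mul'_assoc_symm_tmul, mul_smul]
  | add x y hx hy => simp only [TensorProduct.tmul_add, map_add, hx, hy, smul_add]

/-- If `m` is an associative multiplication on `A⊗V` with a two-sided identity `u` and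
`m((a⊗1_V)⊗(b⊗v)) = ab⊗v`, then `u = 1_A⊗1_V`, `m = smashMul χ F` for the induced maps
`χ(v⊗a) := m((1⊗v)⊗(a⊗1))` and `F(v⊗w) := m((1⊗v)⊗(1⊗w))`, and consequently `χ` is a
twisting map and `F` is a normal cocycle satisfying the twisted module condition. -/
theorem crossed_product_of_mul
    (m : (A ⊗[k] V) ⊗[k] (A ⊗[k] V) →ₗ[k] A ⊗[k] V) (e : V) (u : A ⊗[k] V)
    (hassoc : ∀ x y z : A ⊗[k] V,
      m (m (x ⊗ₜ[k] y) ⊗ₜ[k] z) = m (x ⊗ₜ[k] m (y ⊗ₜ[k] z)))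
    (hul : ∀ x : A ⊗[k] V, m (u ⊗ₜ[k] x) = x)
    (hur : ∀ x : A ⊗[k] V, m (x ⊗ₜ[k] u) = x)
    (hsm : ∀ (a b : A) (v : V), m ((a ⊗ₜ[k] e) ⊗ₜ[k] (b ⊗ₜ[k] v)) = (a * b) ⊗ₜ[k] v) :
    u = (1 : A) ⊗ₜ[k] e ∧
    m = smashMul (inducedTwist m e) (inducedCocycle m) ∧
    IsTwistingMap (inducedTwist m e) e ∧
    IsNormal (inducedCocycle m) e ∧
    IsCocycle (inducedTwist m e) (inducedCocycle m) ∧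
    SatisfiesTwistedModuleCondition (inducedTwist m e) (inducedCocycle m) := by
  have hm := mul_smul_left hassoc hsm
  have hone : ∀ x, m (((1 : A) ⊗ₜ[k] e) ⊗ₜ[k] x) = x := fun x => by
    rw [mul_tmul_distinguished hsm, one_smul]
  have hu : u = (1 : A) ⊗ₜ[k] e := (hone u).symm.trans (hur _)
  subst hu
  have hχ : ∀ v a, inducedTwist m e (v ⊗ₜ[k] a) =
      m (((1 : A) ⊗ₜ[k] v) ⊗ₜ[k] (a ⊗ₜ[k] e)) := fun _ _ => rfl
  have hF : ∀ v w, inducedCocycle m (v ⊗ₜ[k] w) =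
      m (((1 : A) ⊗ₜ[k] v) ⊗ₜ[k] ((1 : A) ⊗ₜ[k] w)) := fun _ _ => rfl
  have hmulχ := map_mul'_lTensor_eq_mul hm (f := fun a => a ⊗ₜ[k] e) hχ
  have hmulF := map_mul'_lTensor_eq_mul hm (f := fun w => (1 : A) ⊗ₜ[k] w) hF
  have htmul : ∀ (a : A) (v : V), m ((a ⊗ₜ[k] e) ⊗ₜ[k] ((1 : A) ⊗ₜ[k] v)) = a ⊗ₜ[k] v :=
    fun a v => by rw [hsm, mul_one]
  have hleft : ∀ (v : V) (x : A ⊗[k] V),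
      TensorProduct.map (LinearMap.mul' k A) (LinearMap.id : V →ₗ[k] V)
        ((TensorProduct.assoc k A A V).symm
          (LinearMap.lTensor A (inducedCocycle m)
            (TensorProduct.assoc k A V V
              (LinearMap.rTensor V (inducedTwist m e)
                ((TensorProduct.assoc k V A V).symm (v ⊗ₜ[k] x)))))) =
      m (((1 : A) ⊗ₜ[k] v) ⊗ₜ[k] x) := fun v x => by
    induction x using TensorProduct.induction_on with
    | zero => simp
    | tmul a w =>
      rw [TensorProduct.assoc_symm_tmul, LinearMap.rTensor_tmul, hmulF, hχ, hassoc, htmul]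
    | add x y hx hy => simp only [TensorProduct.tmul_add, map_add, hx, hy]
  refine ⟨rfl, ?_, ⟨fun v => hur _, fun a => hone _, ?_⟩, ⟨fun v => hone _, fun v => hur _⟩,
    ?_, ?_⟩
  · refine TensorProduct.ext_fourfold' fun a v b w => ?_
    simp only [smashMul, LinearMap.comp_apply, LinearEquiv.coe_coe, TensorProduct.assoc_tmul,
      TensorProduct.assoc_symm_tmul, LinearMap.lTensor_tmul, LinearMap.rTensor_tmul,
      map_mul'_map_mul', hmulF, hχ, hassoc, htmul]
    rw [← hm, TensorProduct.smul_tmul', smul_eq_mul, mul_one]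
  · refine TensorProduct.ext_threefold' fun v a b => ?_
    simp only [LinearMap.comp_apply, LinearEquiv.coe_coe, TensorProduct.assoc_symm_tmul,
      LinearMap.lTensor_tmul, LinearMap.rTensor_tmul, LinearMap.mul'_apply, hmulχ, hχ, hassoc, hsm]
  · refine TensorProduct.ext_threefold' fun v w x => ?_
    simp only [LinearMap.comp_apply, LinearEquiv.coe_coe, TensorProduct.assoc_symm_tmul,
      LinearMap.lTensor_tmul, LinearMap.rTensor_tmul, hmulF, hleft]
    rw [hF, hF, hassoc]
  · refine TensorProduct.ext_threefold' fun v w a => ?_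
    simp only [LinearMap.comp_apply, LinearEquiv.coe_coe, TensorProduct.assoc_symm_tmul,
      LinearMap.lTensor_tmul, LinearMap.rTensor_tmul, hmulχ, hleft]
    rw [hχ, hF, hassoc]
end

section
/- Perturbation Lemma: If δ is a small perturbation of a homotopy equivalence data (i, p, h) between (Y,∂) and (X,d), then the perturbed data is again a homotopy equivalence data: (Y,∂¹) and (X,d+δ) are chain complexes, i¹ : (Y,∂¹) → (X,d+δ) and p¹ : (X,d+δ) → (Y,∂¹) are chain maps which are quasi-isomorphisms, and h¹ is a homotopy from i¹∘p¹ to id_X. Moreover, if the original data is a special deformation retract, then the perturbed data is also a special deformation retract. -/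
/-!
The Perturbation Lemma for non-negatively graded chain complexes of `k`-vector spaces.
-/

universe u

variable {k : Type u} [Field k]
variable {X : ℕ → Type u} [∀ n, AddCommGroup (X n)] [∀ n, Module k (X n)]
variable {Y : ℕ → Type u} [∀ n, AddCommGroup (Y n)] [∀ n, Module k (Y n)]

/-- The cycles of a non-negatively graded chain complex `(X, d)`. -/
def cycles (d : ∀ n, X (n + 1) →ₗ[k] X n) : ∀ n, Submodule k (X n)
  | 0 => ⊤
  | n + 1 => LinearMap.ker (d n)

/-- Homology of a non-negatively graded chain complex `(X, d)` : cycles modulo boundaries. -/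
def homology (d : ∀ n, X (n + 1) →ₗ[k] X n) (n : ℕ) : Type u :=
  ↥(cycles d n) ⧸ (Submodule.comap (cycles d n).subtype (LinearMap.range (d n)))

noncomputable instance homologyAddCommGroup (d : ∀ n, X (n + 1) →ₗ[k] X n) (n : ℕ) :
    AddCommGroup (homology d n) :=
  inferInstanceAs (AddCommGroup (↥(cycles d n) ⧸
    (Submodule.comap (cycles d n).subtype (LinearMap.range (d n)))))

noncomputable instance homologyModule (d : ∀ n, X (n + 1) →ₗ[k] X n) (n : ℕ) :
    Module k (homology d n) :=
  inferInstanceAs (Module k (↥(cycles d n) ⧸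
    (Submodule.comap (cycles d n).subtype (LinearMap.range (d n)))))

/-- A chain map sends cycles to cycles. -/
noncomputable def cyclesMap (d : ∀ n, X (n + 1) →ₗ[k] X n) (e : ∀ n, Y (n + 1) →ₗ[k] Y n)
    (f : ∀ n, X n →ₗ[k] Y n) (hf : ∀ n, f n ∘ₗ d n = e n ∘ₗ f (n + 1)) :
    ∀ n, ↥(cycles d n) →ₗ[k] ↥(cycles e n)
  | 0 => (f 0).restrict fun _ _ => Submodule.mem_top
  | n + 1 => (f (n + 1)).restrict fun x hx => by
      have h1 := LinearMap.congr_fun (hf n) x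
      simp only [LinearMap.comp_apply] at h1
      have hx' : d n x = 0 := hx
      show f (n + 1) x ∈ LinearMap.ker (e n)
      rw [LinearMap.mem_ker, ← h1, hx', map_zero]

/-- The map on homology induced by a chain map. -/
noncomputable def homologyMap (d : ∀ n, X (n + 1) →ₗ[k] X n) (e : ∀ n, Y (n + 1) →ₗ[k] Y n)
    (f : ∀ n, X n →ₗ[k] Y n) (hf : ∀ n, f n ∘ₗ d n = e n ∘ₗ f (n + 1)) (n : ℕ) :
    homology d n →ₗ[k] homology e n :=
  Submodule.mapQ _ _ (cyclesMap d e f hf n) (by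
    intro x hx
    have hcoe : ∀ (m : ℕ) (z : ↥(cycles d m)),
        ((cyclesMap d e f hf m z : ↥(cycles e m)) : Y m) = f m (z : X m) := by
      intro m
      cases m with
      | zero => intro z; rfl
      | succ l => intro z; rfl
    simp only [Submodule.mem_comap, Submodule.coe_subtype] at hx ⊢
    obtain ⟨y, hy⟩ := hx
    have h1 := LinearMap.congr_fun (hf n) y
    simp only [LinearMap.comp_apply] at h1
    refine ⟨f (n + 1) y, ?_⟩
    rw [hcoe n x, ← h1, hy])

/-- The degree-lowering map `A := (id − δ∘h)⁻¹∘δ` of the perturbation lemma. -/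
noncomputable def pertA (δ : ∀ n, X (n + 1) →ₗ[k] X n) (h : ∀ n, X n →ₗ[k] X (n + 1))
    (n : ℕ) : X (n + 1) →ₗ[k] X n :=
  (Ring.inverse ((1 : Module.End k (X n)) - (δ n ∘ₗ h n))) ∘ₗ δ n

/-- The perturbed map `i¹ := i + h∘A∘i`. -/
noncomputable def pertI (i : ∀ n, Y n →ₗ[k] X n) (δ : ∀ n, X (n + 1) →ₗ[k] X n)
    (h : ∀ n, X n →ₗ[k] X (n + 1)) : ∀ n, Y n →ₗ[k] X n
  | 0 => i 0
  | n + 1 => i (n + 1) + h n ∘ₗ pertA δ h n ∘ₗ i (n + 1)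

/-- The perturbed map `p¹ := p + p∘A∘h`. -/
noncomputable def pertP (p : ∀ n, X n →ₗ[k] Y n) (δ : ∀ n, X (n + 1) →ₗ[k] X n)
    (h : ∀ n, X n →ₗ[k] X (n + 1)) (n : ℕ) : X n →ₗ[k] Y n :=
  p n + p n ∘ₗ pertA δ h n ∘ₗ h n

/-- The perturbed homotopy `h¹ := h + h∘A∘h`. -/
noncomputable def pertH (δ : ∀ n, X (n + 1) →ₗ[k] X n) (h : ∀ n, X n →ₗ[k] X (n + 1))
    (n : ℕ) : X n →ₗ[k] X (n + 1) :=
  h n + h n ∘ₗ pertA δ h n ∘ₗ h n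

/-- The perturbed differential `∂¹ := ∂ + p∘A∘i` on `Y`. -/
noncomputable def pertD (eY : ∀ n, Y (n + 1) →ₗ[k] Y n) (i : ∀ n, Y n →ₗ[k] X n)
    (p : ∀ n, X n →ₗ[k] Y n) (δ : ∀ n, X (n + 1) →ₗ[k] X n)
    (h : ∀ n, X n →ₗ[k] X (n + 1)) (n : ℕ) : Y (n + 1) →ₗ[k] Y n :=
  eY n + p n ∘ₗ pertA δ h n ∘ₗ i (n + 1)

section Homology

variable {d : ∀ n, X (n + 1) →ₗ[k] X n} {e : ∀ n, Y (n + 1) →ₗ[k] Y n}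
  {f : ∀ n, X n →ₗ[k] Y n} {hf : ∀ n, f n ∘ₗ d n = e n ∘ₗ f (n + 1)} {n : ℕ}

theorem cyclesMap_coe (z : cycles d n) : (cyclesMap d e f hf n z : Y n) = f n z := by
  cases n <;> rfl

theorem mem_cycles_succ {x : X (n + 1)} : x ∈ cycles d (n + 1) ↔ d n x = 0 :=
  LinearMap.mem_ker

theorem homologyMap_injective_iff :
    Function.Injective (homologyMap d e f hf n) ↔
      ∀ x ∈ cycles d n, ∀ y, f n x = e n y → ∃ z, d n z = x := by
  rw [injective_iff_map_eq_zero]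
  constructor
  · intro H x hx y hy
    have hz : homologyMap d e f hf n (Submodule.Quotient.mk ⟨x, hx⟩) = 0 := by
      refine (Submodule.Quotient.mk_eq_zero _).2 ⟨y, ?_⟩
      exact hy.symm.trans (cyclesMap_coe (hf := hf) ⟨x, hx⟩).symm
    exact (Submodule.Quotient.mk_eq_zero _).1 (H _ hz)
  · intro H a ha
    obtain ⟨⟨x, hx⟩, rfl⟩ := Submodule.Quotient.mk_surjective _ a
    obtain ⟨y, hy⟩ := (Submodule.Quotient.mk_eq_zero _).1 ha
    refine (Submodule.Quotient.mk_eq_zero _).2 (H x hx y ?_)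
    exact (cyclesMap_coe (hf := hf) ⟨x, hx⟩).symm.trans hy.symm

theorem homologyMap_surjective_iff :
    Function.Surjective (homologyMap d e f hf n) ↔
      ∀ y ∈ cycles e n, ∃ x ∈ cycles d n, ∃ w, f n x - y = e n w := by
  constructor
  · intro H y hy
    obtain ⟨a, ha⟩ := H (Submodule.Quotient.mk ⟨y, hy⟩)
    obtain ⟨⟨x, hx⟩, rfl⟩ := Submodule.Quotient.mk_surjective _ a
    obtain ⟨w, hw⟩ := (Submodule.Quotient.eq _).1 ha
    refine ⟨x, hx, w, ?_⟩
    rw [hw, Submodule.subtype_apply, Submodule.coe_sub, cyclesMap_coe]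
  · intro H b
    obtain ⟨⟨y, hy⟩, rfl⟩ := Submodule.Quotient.mk_surjective _ b
    obtain ⟨x, hx, w, hw⟩ := H y hy
    refine ⟨Submodule.Quotient.mk ⟨x, hx⟩, (Submodule.Quotient.eq _).2 ⟨w, ?_⟩⟩
    rw [← hw, Submodule.subtype_apply, Submodule.coe_sub, cyclesMap_coe]

theorem map_mem_cycles (hf : ∀ n, f n ∘ₗ d n = e n ∘ₗ f (n + 1)) {x : X n}
    (hx : x ∈ cycles d n) : f n x ∈ cycles e n :=
  cyclesMap_coe (hf := hf) ⟨x, hx⟩ ▸ (cyclesMap d e f hf n ⟨x, hx⟩).2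

end Homology

section Perturbation

variable {d δ : ∀ n, X (n + 1) →ₗ[k] X n} {eY : ∀ n, Y (n + 1) →ₗ[k] Y n}
  {i : ∀ n, Y n →ₗ[k] X n} {p : ∀ n, X n →ₗ[k] Y n} {h : ∀ n, X n →ₗ[k] X (n + 1)}

theorem pertA_eq_left (n : ℕ) (hu : IsUnit ((1 : Module.End k (X n)) - δ n ∘ₗ h n))
    (x : X (n + 1)) : pertA δ h n x = δ n x + δ n (h n (pertA δ h n x)) := by
  have := LinearMap.congr_fun (Ring.mul_inverse_cancel _ hu) (δ n x)
  simpa [pertA, sub_eq_iff_eq_add] using this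

theorem pertA_eq_right (n : ℕ) (hu : IsUnit ((1 : Module.End k (X n)) - δ n ∘ₗ h n))
    (x : X (n + 1)) : pertA δ h n x = δ n x + pertA δ h n (h n (δ n x)) := by
  have := LinearMap.congr_fun (Ring.inverse_mul_cancel _ hu) (δ n x)
  simpa [pertA, sub_eq_iff_eq_add] using this

/-- The fundamental identity `d∘A + A∘d + A∘i∘p∘A = 0`. -/
theorem pertA_relation (n : ℕ) (hu : ∀ n, IsUnit ((1 : Module.End k (X n)) - δ n ∘ₗ h n))
    (hd : ∀ n, d n ∘ₗ d (n + 1) = 0)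
    (hhs : ∀ n, d (n + 1) ∘ₗ h (n + 1) + h n ∘ₗ d n = i (n + 1) ∘ₗ p (n + 1) - LinearMap.id)
    (hδ : ∀ n, (d n + δ n) ∘ₗ (d (n + 1) + δ (n + 1)) = 0) (x : X (n + 2)) :
    d n (pertA δ h (n + 1) x) + pertA δ h n (d (n + 1) x)
      + pertA δ h n (i (n + 1) (p (n + 1) (pertA δ h (n + 1) x))) = 0 := by
  set a := pertA δ h (n + 1) x with ha
  have inj : Function.Injective ((1 : Module.End k (X n)) - δ n ∘ₗ h n) :=
    ((Module.End.isUnit_iff _).1 (hu n)).1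
  apply inj
  have ea : a = δ (n + 1) x + δ (n + 1) (h (n + 1) a) := pertA_eq_left _ (hu _) x
  have e1 := pertA_eq_left n (hu n) (d (n + 1) x)
  have e2 := pertA_eq_left n (hu n) (i (n + 1) (p (n + 1) a))
  have e3 := congrArg (δ n) (LinearMap.congr_fun (hhs n) a)
  have e4 := LinearMap.congr_fun (hδ n) x
  have e5 := LinearMap.congr_fun (hδ n) (h (n + 1) a)
  have e6 := LinearMap.congr_fun (hd n) x
  have e7 := LinearMap.congr_fun (hd n) (h (n + 1) a)
  have e8 := congrArg (d n) ea
  have e9 := congrArg (δ n) ea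
  simp only [LinearMap.add_apply, LinearMap.sub_apply, LinearMap.comp_apply, map_add, map_sub,
    LinearMap.id_apply, LinearMap.zero_apply, Module.End.one_apply, map_zero] at *
  linear_combination (norm := abel) e1 + e2 - e3 + e4 + e5 - e6 - e7 + e8 + e9

theorem pertD_comp_pertD (hu : ∀ n, IsUnit ((1 : Module.End k (X n)) - δ n ∘ₗ h n))
    (hd : ∀ n, d n ∘ₗ d (n + 1) = 0) (he : ∀ n, eY n ∘ₗ eY (n + 1) = 0)
    (hi : ∀ n, i n ∘ₗ eY n = d n ∘ₗ i (n + 1)) (hp : ∀ n, p n ∘ₗ d n = eY n ∘ₗ p (n + 1))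
    (hhs : ∀ n, d (n + 1) ∘ₗ h (n + 1) + h n ∘ₗ d n = i (n + 1) ∘ₗ p (n + 1) - LinearMap.id)
    (hδ : ∀ n, (d n + δ n) ∘ₗ (d (n + 1) + δ (n + 1)) = 0) (n : ℕ) :
    pertD eY i p δ h n ∘ₗ pertD eY i p δ h (n + 1) = 0 := by
  ext y
  have e1 := congrArg (p n) (pertA_relation n hu hd hhs hδ (i (n + 2) y))
  have e2 := LinearMap.congr_fun (he n) y
  have e3 := congrArg (fun z => p n (pertA δ h n z)) (LinearMap.congr_fun (hi (n + 1)) y)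
  have e4 := LinearMap.congr_fun (hp n) (pertA δ h (n + 1) (i (n + 2) y))
  simp only [pertD, LinearMap.add_apply, LinearMap.comp_apply, map_add, map_zero,
    LinearMap.zero_apply] at *
  linear_combination (norm := abel) e1 + e2 + e3 - e4

theorem pertI_comp_pertD (hu : ∀ n, IsUnit ((1 : Module.End k (X n)) - δ n ∘ₗ h n))
    (hd : ∀ n, d n ∘ₗ d (n + 1) = 0) (hi : ∀ n, i n ∘ₗ eY n = d n ∘ₗ i (n + 1))
    (hh0 : d 0 ∘ₗ h 0 = i 0 ∘ₗ p 0 - LinearMap.id)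
    (hhs : ∀ n, d (n + 1) ∘ₗ h (n + 1) + h n ∘ₗ d n = i (n + 1) ∘ₗ p (n + 1) - LinearMap.id)
    (hδ : ∀ n, (d n + δ n) ∘ₗ (d (n + 1) + δ (n + 1)) = 0) (n : ℕ) :
    pertI i δ h n ∘ₗ pertD eY i p δ h n = (d n + δ n) ∘ₗ pertI i δ h (n + 1) := by
  ext y
  have e1 := LinearMap.congr_fun (hi n) y
  have e2 := pertA_eq_left n (hu n) (i (n + 1) y)
  cases n with
  | zero =>
    have e3 := LinearMap.congr_fun hh0 (pertA δ h 0 (i 1 y))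
    simp only [pertD, pertI, LinearMap.add_apply, LinearMap.sub_apply, LinearMap.id_apply,
      LinearMap.comp_apply, map_add] at *
    linear_combination (norm := abel) e1 + e2 - e3
  | succ n =>
    have e3 := LinearMap.congr_fun (hhs n) (pertA δ h (n + 1) (i (n + 2) y))
    have e4 := congrArg (h n) (pertA_relation n hu hd hhs hδ (i (n + 2) y))
    have e5 := congrArg (fun z => h n (pertA δ h n z)) e1
    simp only [pertD, pertI, LinearMap.add_apply, LinearMap.sub_apply, LinearMap.id_apply,
      LinearMap.comp_apply, map_add, map_zero] at *
    linear_combination (norm := abel) e1 + e2 - e3 + e4 + e5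

theorem pertP_comp_add (hu : ∀ n, IsUnit ((1 : Module.End k (X n)) - δ n ∘ₗ h n))
    (hd : ∀ n, d n ∘ₗ d (n + 1) = 0) (hp : ∀ n, p n ∘ₗ d n = eY n ∘ₗ p (n + 1))
    (hhs : ∀ n, d (n + 1) ∘ₗ h (n + 1) + h n ∘ₗ d n = i (n + 1) ∘ₗ p (n + 1) - LinearMap.id)
    (hδ : ∀ n, (d n + δ n) ∘ₗ (d (n + 1) + δ (n + 1)) = 0) (n : ℕ) :
    pertP p δ h n ∘ₗ (d n + δ n) = pertD eY i p δ h n ∘ₗ pertP p δ h (n + 1) := by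
  ext x
  have e1 := LinearMap.congr_fun (hp n) x
  have e2 := LinearMap.congr_fun (hp n) (pertA δ h (n + 1) (h (n + 1) x))
  have e3 := congrArg (p n) (pertA_eq_right n (hu n) x)
  have e4 := congrArg (fun z => p n (pertA δ h n z)) (LinearMap.congr_fun (hhs n) x)
  have e5 := congrArg (p n) (pertA_relation n hu hd hhs hδ (h (n + 1) x))
  simp only [pertD, pertP, LinearMap.add_apply, LinearMap.sub_apply, LinearMap.id_apply,
    LinearMap.comp_apply, map_add, map_sub, map_zero] at *
  linear_combination (norm := abel) e1 + e2 - e3 + e4 - e5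

theorem add_comp_pertH_zero (hu : ∀ n, IsUnit ((1 : Module.End k (X n)) - δ n ∘ₗ h n))
    (hh0 : d 0 ∘ₗ h 0 = i 0 ∘ₗ p 0 - LinearMap.id) :
    (d 0 + δ 0) ∘ₗ pertH δ h 0 = pertI i δ h 0 ∘ₗ pertP p δ h 0 - LinearMap.id := by
  ext x
  have e1 := LinearMap.congr_fun hh0 x
  have e2 := LinearMap.congr_fun hh0 (pertA δ h 0 (h 0 x))
  have e3 := pertA_eq_left 0 (hu 0) (h 0 x)
  simp only [pertH, pertI, pertP, LinearMap.add_apply, LinearMap.sub_apply, LinearMap.id_apply,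
    LinearMap.comp_apply, map_add] at *
  linear_combination (norm := abel) e1 + e2 - e3

theorem add_comp_pertH_succ (hu : ∀ n, IsUnit ((1 : Module.End k (X n)) - δ n ∘ₗ h n))
    (hd : ∀ n, d n ∘ₗ d (n + 1) = 0)
    (hhs : ∀ n, d (n + 1) ∘ₗ h (n + 1) + h n ∘ₗ d n = i (n + 1) ∘ₗ p (n + 1) - LinearMap.id)
    (hδ : ∀ n, (d n + δ n) ∘ₗ (d (n + 1) + δ (n + 1)) = 0) (n : ℕ) :
    (d (n + 1) + δ (n + 1)) ∘ₗ pertH δ h (n + 1) + pertH δ h n ∘ₗ (d n + δ n)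
      = pertI i δ h (n + 1) ∘ₗ pertP p δ h (n + 1) - LinearMap.id := by
  ext x
  have e1 := LinearMap.congr_fun (hhs n) x
  have e2 := LinearMap.congr_fun (hhs n) (pertA δ h (n + 1) (h (n + 1) x))
  have e3 := pertA_eq_left (n + 1) (hu _) (h (n + 1) x)
  have e4 := congrArg (h n) (pertA_eq_right n (hu n) x)
  have e5 := congrArg (fun z => h n (pertA δ h n z)) (LinearMap.congr_fun (hhs n) x)
  have e6 := congrArg (h n) (pertA_relation n hu hd hhs hδ (h (n + 1) x))
  simp only [pertH, pertI, pertP, LinearMap.add_apply, LinearMap.sub_apply, LinearMap.id_apply,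
    LinearMap.comp_apply, map_add, map_sub, map_zero] at *
  linear_combination (norm := abel) e1 + e2 - e3 - e4 + e5 - e6

theorem pertP_comp_pertI (hpi : ∀ n, p n ∘ₗ i n = LinearMap.id) (hhi : ∀ n, h n ∘ₗ i n = 0)
    (hph : ∀ n, p (n + 1) ∘ₗ h n = 0) (hhh : ∀ n, h (n + 1) ∘ₗ h n = 0) (n : ℕ) :
    pertP p δ h n ∘ₗ pertI i δ h n = LinearMap.id := by
  simp only [LinearMap.ext_iff, LinearMap.comp_apply, LinearMap.zero_apply,
    LinearMap.id_apply] at *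
  cases n <;> simp [pertP, pertI, *]

theorem pertH_comp_pertI (hhi : ∀ n, h n ∘ₗ i n = 0) (hhh : ∀ n, h (n + 1) ∘ₗ h n = 0) (n : ℕ) :
    pertH δ h n ∘ₗ pertI i δ h n = 0 := by
  simp only [LinearMap.ext_iff, LinearMap.comp_apply, LinearMap.zero_apply] at *
  cases n <;> simp [pertH, pertI, *]

theorem pertP_comp_pertH (hph : ∀ n, p (n + 1) ∘ₗ h n = 0) (hhh : ∀ n, h (n + 1) ∘ₗ h n = 0)
    (n : ℕ) : pertP p δ h (n + 1) ∘ₗ pertH δ h n = 0 := by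
  simp only [LinearMap.ext_iff, LinearMap.comp_apply, LinearMap.zero_apply] at *
  simp [pertP, pertH, *]

theorem pertH_comp_pertH (hhh : ∀ n, h (n + 1) ∘ₗ h n = 0) (n : ℕ) :
    pertH δ h (n + 1) ∘ₗ pertH δ h n = 0 := by
  simp only [LinearMap.ext_iff, LinearMap.comp_apply, LinearMap.zero_apply] at *
  simp [pertH, *]

theorem pertP_sub (n : ℕ) (hu : IsUnit ((1 : Module.End k (X n)) - δ n ∘ₗ h n)) (x : X n) :
    pertP p δ h n (x - δ n (h n x)) = p n x := by
  have := congrArg (p n) (pertA_eq_right n hu (h n x))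
  simp only [pertP, LinearMap.add_apply, LinearMap.comp_apply, map_add, map_sub] at *
  linear_combination (norm := abel) this

theorem pertP_apply_delta (n : ℕ) (hu : IsUnit ((1 : Module.End k (X n)) - δ n ∘ₗ h n))
    (x : X (n + 1)) : pertP p δ h n (δ n x) = p n (pertA δ h n x) := by
  rw [pertA_eq_right n hu x]
  simp [pertP]

/-- The element `(y, A i y)` is a cycle of the mapping cone of `p` whenever `∂¹ y = 0`, and the
acyclicity of this cone exhibits it as a boundary. -/
theorem exists_cone_boundary (hu : ∀ n, IsUnit ((1 : Module.End k (X n)) - δ n ∘ₗ h n))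
    (hd : ∀ n, d n ∘ₗ d (n + 1) = 0)
    (hi : ∀ n, i n ∘ₗ eY n = d n ∘ₗ i (n + 1)) (hp : ∀ n, p n ∘ₗ d n = eY n ∘ₗ p (n + 1))
    (hhs : ∀ n, d (n + 1) ∘ₗ h (n + 1) + h n ∘ₗ d n = i (n + 1) ∘ₗ p (n + 1) - LinearMap.id)
    (hδ : ∀ n, (d n + δ n) ∘ₗ (d (n + 1) + δ (n + 1)) = 0)
    (hpq : ∀ n, Function.Bijective (homologyMap d eY p hp n)) (n : ℕ) (y : Y (n + 1))
    (hy : pertD eY i p δ h n y = 0) :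
    ∃ v w, d n v = pertA δ h n (i (n + 1) y) ∧ eY (n + 1) w = p (n + 1) v + y := by
  set u := pertA δ h n (i (n + 1) y) with hu_def
  have hy' : eY n y + p n u = 0 := hy
  have hu_cyc : u ∈ cycles d n := by
    cases n with
    | zero => exact Submodule.mem_top
    | succ n =>
      rw [mem_cycles_succ]
      have e1 := pertA_relation n hu hd hhs hδ (i (n + 2) y)
      have e2 := congrArg (fun z => pertA δ h n (i (n + 1) z)) hy'
      have e3 := congrArg (pertA δ h n) (LinearMap.congr_fun (hi (n + 1)) y)
      simp only [LinearMap.comp_apply, map_add, map_zero] at e2 e3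
      rw [← hu_def] at e1
      linear_combination (norm := abel) e1 - e2 + e3
  obtain ⟨v, hv⟩ := homologyMap_injective_iff.1 (hpq n).1 u hu_cyc (-y) (by
    rw [map_neg]; linear_combination (norm := abel) hy')
  have hpv : p n (d n v) = eY n (p (n + 1) v) := LinearMap.congr_fun (hp n) v
  obtain ⟨z, hz, w, hw⟩ := homologyMap_surjective_iff.1 (hpq (n + 1)).2 (p (n + 1) v + y)
    (mem_cycles_succ.2 (by rw [map_add, ← hpv, hv, add_comm, hy']))
  refine ⟨v - z, -w, ?_, ?_⟩
  · rw [map_sub, mem_cycles_succ.1 hz, hv, sub_zero]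
  · rw [map_neg, map_sub, ← hw]
    abel

theorem homologyMap_pertI_injective
    (hu : ∀ n, IsUnit ((1 : Module.End k (X n)) - δ n ∘ₗ h n))
    (hd : ∀ n, d n ∘ₗ d (n + 1) = 0)
    (hi : ∀ n, i n ∘ₗ eY n = d n ∘ₗ i (n + 1)) (hp : ∀ n, p n ∘ₗ d n = eY n ∘ₗ p (n + 1))
    (hh0 : d 0 ∘ₗ h 0 = i 0 ∘ₗ p 0 - LinearMap.id)
    (hhs : ∀ n, d (n + 1) ∘ₗ h (n + 1) + h n ∘ₗ d n = i (n + 1) ∘ₗ p (n + 1) - LinearMap.id)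
    (hδ : ∀ n, (d n + δ n) ∘ₗ (d (n + 1) + δ (n + 1)) = 0)
    (hpq : ∀ n, Function.Bijective (homologyMap d eY p hp n))
    (hi1 : ∀ n, pertI i δ h n ∘ₗ pertD eY i p δ h n = (d n + δ n) ∘ₗ pertI i δ h (n + 1))
    (n : ℕ) : Function.Injective (homologyMap (X := Y) (Y := X) (pertD eY i p δ h)
      (fun n => d n + δ n) (pertI i δ h) hi1 n) := by
  refine homologyMap_injective_iff.2 fun y hy x hx => ?_
  suffices H : ∃ v w, eY n w = p n v + y ∧ pertI i δ h n y + v + d n (h n v)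
      = i n (eY n w) by
    obtain ⟨v, w, hw, hvw⟩ := H
    refine ⟨w + pertP p δ h (n + 1) (x - i (n + 1) w + h n v), ?_⟩
    have e1 := LinearMap.congr_fun (pertP_comp_add (eY := eY) hu hd hp hhs hδ n)
      (x - i (n + 1) w + h n v)
    have e2 := congrArg (pertP p δ h n) hx
    have e3 := congrArg (pertP p δ h n) hvw
    have e4 := congrArg (pertP p δ h n) (LinearMap.congr_fun (hi n) w)
    have e5 := pertP_sub (p := p) n (hu n) v
    have e6 := pertP_apply_delta (p := p) n (hu n) (i (n + 1) w)
    have e7 : pertD eY i p δ h n w = eY n w + p n (pertA δ h n (i (n + 1) w)) := rfl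
    simp only [LinearMap.add_apply, LinearMap.comp_apply, map_add, map_sub] at *
    linear_combination (norm := abel) e7 + hw - e1 - e2 + e3 + e4 - e5 - e6
  cases n with
  | zero =>
    obtain ⟨v, -, w, hw⟩ := homologyMap_surjective_iff.1 (hpq 0).2 (-y) Submodule.mem_top
    have e1 := LinearMap.congr_fun hh0 v
    have e2 := congrArg (i 0) hw
    refine ⟨v, w, by rw [← hw]; abel, ?_⟩
    simp only [pertI, LinearMap.sub_apply, LinearMap.id_apply, LinearMap.comp_apply,
      map_sub, map_neg] at *
    linear_combination (norm := abel) e1 + e2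
  | succ n =>
    obtain ⟨v, w, hv, hw⟩ := exists_cone_boundary hu hd hi hp hhs hδ hpq n y
      (mem_cycles_succ.1 hy)
    have e1 := LinearMap.congr_fun (hhs n) v
    have e2 := congrArg (i (n + 1)) hw
    have e3 := congrArg (h n) hv
    refine ⟨v, w, hw, ?_⟩
    simp only [pertI, LinearMap.add_apply, LinearMap.sub_apply, LinearMap.id_apply,
      LinearMap.comp_apply, map_add] at *
    linear_combination (norm := abel) e1 - e2 - e3

end Perturbation

/-- If `f∘g` is homotopic to the identity via `s` and `f` is injective on homology, then `f` and
`g` are both bijective on homology. -/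
theorem homologyMap_bijective_of_homotopy {d : ∀ n, X (n + 1) →ₗ[k] X n}
    {e : ∀ n, Y (n + 1) →ₗ[k] Y n} {f : ∀ n, Y n →ₗ[k] X n} {g : ∀ n, X n →ₗ[k] Y n}
    {s : ∀ n, X n →ₗ[k] X (n + 1)} (hf : ∀ n, f n ∘ₗ e n = d n ∘ₗ f (n + 1))
    (hg : ∀ n, g n ∘ₗ d n = e n ∘ₗ g (n + 1))
    (hs0 : d 0 ∘ₗ s 0 = f 0 ∘ₗ g 0 - LinearMap.id)
    (hs : ∀ n, d (n + 1) ∘ₗ s (n + 1) + s n ∘ₗ d n = f (n + 1) ∘ₗ g (n + 1) - LinearMap.id)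
    (n : ℕ) (hinj : Function.Injective (homologyMap e d f hf n)) :
    Function.Bijective (homologyMap e d f hf n) ∧ Function.Bijective (homologyMap d e g hg n) := by
  have key : ∀ x ∈ cycles d n, f n (g n x) - x = d n (s n x) := by
    intro x hx
    cases n with
    | zero => exact (LinearMap.congr_fun hs0 x).symm
    | succ n =>
      have := LinearMap.congr_fun (hs n) x
      simpa [mem_cycles_succ.1 hx, eq_comm] using this
  refine ⟨⟨hinj, homologyMap_surjective_iff.2 fun x hx =>
    ⟨g n x, map_mem_cycles hg hx, s n x, key x hx⟩⟩,
    homologyMap_injective_iff.2 fun x hx y hy => ⟨f (n + 1) y - s n x, ?_⟩,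
    homologyMap_surjective_iff.2 fun y hy => ⟨f n y, map_mem_cycles hf hy, ?_⟩⟩
  · have := LinearMap.congr_fun (hf n) y
    simp only [LinearMap.comp_apply] at this
    rw [map_sub, ← key x hx, hy, this]
    abel
  · have hy' := map_mem_cycles hf hy
    obtain ⟨w, hw⟩ := homologyMap_injective_iff.1 hinj (g n (f n y) - y)
      (Submodule.sub_mem _ (map_mem_cycles hg hy') hy) (s n (f n y)) (by
        rw [map_sub, key _ hy'])
    exact ⟨w, hw.symm⟩

/-- **The Perturbation Lemma.**  Given a homotopy equivalence data
`(Y,∂) ⇄ (X,d)` with homotopy `h` from `i∘p` to `id`, and a small perturbation `δ` of `d`,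
the perturbed data `(Y,∂¹) ⇄ (X,d+δ)` (with `i¹, p¹, h¹`) is again a homotopy equivalence
data; moreover if the original data is a special deformation retract then so is the
perturbed one. -/
theorem perturbation_lemma
    (d : ∀ n, X (n + 1) →ₗ[k] X n) (eY : ∀ n, Y (n + 1) →ₗ[k] Y n)
    (hd : ∀ n, d n ∘ₗ d (n + 1) = 0) (he : ∀ n, eY n ∘ₗ eY (n + 1) = 0)
    (i : ∀ n, Y n →ₗ[k] X n) (p : ∀ n, X n →ₗ[k] Y n)
    (hi : ∀ n, i n ∘ₗ eY n = d n ∘ₗ i (n + 1))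
    (hp : ∀ n, p n ∘ₗ d n = eY n ∘ₗ p (n + 1))
    (hiq : ∀ n, Function.Bijective (homologyMap eY d i hi n))
    (hpq : ∀ n, Function.Bijective (homologyMap d eY p hp n))
    (h : ∀ n, X n →ₗ[k] X (n + 1))
    (hh0 : d 0 ∘ₗ h 0 = i 0 ∘ₗ p 0 - LinearMap.id)
    (hhs : ∀ n, d (n + 1) ∘ₗ h (n + 1) + h n ∘ₗ d n = i (n + 1) ∘ₗ p (n + 1) - LinearMap.id)
    (δ : ∀ n, X (n + 1) →ₗ[k] X n)
    (hδ : ∀ n, (d n + δ n) ∘ₗ (d (n + 1) + δ (n + 1)) = 0)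
    (hsmall : ∀ n, IsUnit ((1 : Module.End k (X n)) - (δ n ∘ₗ h n))) :
    -- `(X, d+δ)` and `(Y, ∂¹)` are chain complexes
    (∀ n, (d n + δ n) ∘ₗ (d (n + 1) + δ (n + 1)) = 0) ∧
    (∀ n, pertD eY i p δ h n ∘ₗ pertD eY i p δ h (n + 1) = 0) ∧
    -- `i¹` and `p¹` are chain maps
    (∀ n, pertI i δ h n ∘ₗ pertD eY i p δ h n = (d n + δ n) ∘ₗ pertI i δ h (n + 1)) ∧
    (∀ n, pertP p δ h n ∘ₗ (d n + δ n) = pertD eY i p δ h n ∘ₗ pertP p δ h (n + 1)) ∧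
    -- `i¹` and `p¹` are quasi-isomorphisms
    (∀ hi1 : (∀ n, pertI i δ h n ∘ₗ pertD eY i p δ h n = (d n + δ n) ∘ₗ pertI i δ h (n + 1)),
      ∀ n, Function.Bijective
        (homologyMap (X := Y) (Y := X) (pertD eY i p δ h) (fun n => d n + δ n)
          (pertI i δ h) hi1 n)) ∧
    (∀ hp1 : (∀ n, pertP p δ h n ∘ₗ (d n + δ n) = pertD eY i p δ h n ∘ₗ pertP p δ h (n + 1)),
      ∀ n, Function.Bijective
        (homologyMap (X := X) (Y := Y) (fun n => d n + δ n) (pertD eY i p δ h)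
          (pertP p δ h) hp1 n)) ∧
    -- `h¹` is a homotopy from `i¹∘p¹` to `id`
    ((d 0 + δ 0) ∘ₗ pertH δ h 0 = pertI i δ h 0 ∘ₗ pertP p δ h 0 - LinearMap.id) ∧
    (∀ n, (d (n + 1) + δ (n + 1)) ∘ₗ pertH δ h (n + 1) + pertH δ h n ∘ₗ (d n + δ n)
        = pertI i δ h (n + 1) ∘ₗ pertP p δ h (n + 1) - LinearMap.id) ∧
    -- if the original data is a special deformation retract then so is the perturbed one
    ((∀ n, p n ∘ₗ i n = LinearMap.id) → (∀ n, h n ∘ₗ i n = 0) →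
      (∀ n, p (n + 1) ∘ₗ h n = 0) → (∀ n, h (n + 1) ∘ₗ h n = 0) →
      (∀ n, pertP p δ h n ∘ₗ pertI i δ h n = LinearMap.id) ∧
      (∀ n, pertH δ h n ∘ₗ pertI i δ h n = 0) ∧
      (∀ n, pertP p δ h (n + 1) ∘ₗ pertH δ h n = 0) ∧
      (∀ n, pertH δ h (n + 1) ∘ₗ pertH δ h n = 0)) := by
  have hD := pertD_comp_pertD hsmall hd he hi hp hhs hδ
  have hI := pertI_comp_pertD hsmall hd hi hh0 hhs hδ
  have hP := pertP_comp_add (eY := eY) hsmall hd hp hhs hδ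
  have hH0 := add_comp_pertH_zero hsmall hh0
  have hHs := add_comp_pertH_succ hsmall hd hhs hδ
  have hq (n : ℕ) := homologyMap_bijective_of_homotopy (d := fun n => d n + δ n) hI hP hH0 hHs n
    (homologyMap_pertI_injective hsmall hd hi hp hh0 hhs hδ hpq hI n)
  exact ⟨hδ, hD, hI, hP, fun _ n => (hq n).1, fun _ n => (hq n).2, hH0, hHs,
    fun hpi hhi hph hhh => ⟨pertP_comp_pertI hpi hhi hph hhh, pertH_comp_pertI hhi hhh,
      pertP_comp_pertH hph hhh, pertH_comp_pertH hhh⟩⟩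
end

section
/- The k-vector space C1⊗C2 endowed with the comultiplication Δ_{C1⊗_cC2} := (id_{C1}⊗c⊗id_{C2})∘(Δ_1⊗Δ_2) and the counit ε_1⊗ε_2 is a coassociative counital k-coalgebra (denoted C1⊗_c C2). -/
/-!
If `C1`, `C2` are coassociative counital `k`-coalgebras and `c : C1⊗C2 → C2⊗C1` is
compatible with both coalgebra structures, then `C1⊗C2` with comultiplication
`(id⊗c⊗id)∘(Δ₁⊗Δ₂)` and counit `ε₁⊗ε₂` is a coassociative counital coalgebra.
-/

open scoped TensorProduct

universe u

variable {k : Type u} [Field k]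
variable {C1 : Type u} [AddCommGroup C1] [Module k C1] [Coalgebra k C1]
variable {C2 : Type u} [AddCommGroup C2] [Module k C2] [Coalgebra k C2]

/-- `c` is compatible with the coalgebra structure of `C1`:
`(id_{C2}⊗ε₁)∘c = ε₁⊗id_{C2}` and `(id_{C2}⊗Δ₁)∘c = (c⊗id_{C1})∘(id_{C1}⊗c)∘(Δ₁⊗id_{C2})`. -/
def CompatFirst (c : C1 ⊗[k] C2 →ₗ[k] C2 ⊗[k] C1) : Prop :=
  ((TensorProduct.rid k C2).toLinearMap
      ∘ₗ LinearMap.lTensor C2 (Coalgebra.counit (R := k) (A := C1)) ∘ₗ c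
    = (TensorProduct.lid k C2).toLinearMap
      ∘ₗ LinearMap.rTensor C2 (Coalgebra.counit (R := k) (A := C1))) ∧
  (LinearMap.lTensor C2 (Coalgebra.comul (R := k) (A := C1)) ∘ₗ c
    = (TensorProduct.assoc k C2 C1 C1).toLinearMap
      ∘ₗ LinearMap.rTensor C1 c
      ∘ₗ (TensorProduct.assoc k C1 C2 C1).symm.toLinearMap
      ∘ₗ LinearMap.lTensor C1 c
      ∘ₗ (TensorProduct.assoc k C1 C1 C2).toLinearMap
      ∘ₗ LinearMap.rTensor C2 (Coalgebra.comul (R := k) (A := C1)))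

/-- `c` is compatible with the coalgebra structure of `C2`:
`(ε₂⊗id_{C1})∘c = id_{C1}⊗ε₂` and `(Δ₂⊗id_{C1})∘c = (id_{C2}⊗c)∘(c⊗id_{C2})∘(id_{C1}⊗Δ₂)`. -/
def CompatSecond (c : C1 ⊗[k] C2 →ₗ[k] C2 ⊗[k] C1) : Prop :=
  ((TensorProduct.lid k C1).toLinearMap
      ∘ₗ LinearMap.rTensor C1 (Coalgebra.counit (R := k) (A := C2)) ∘ₗ c
    = (TensorProduct.rid k C1).toLinearMap
      ∘ₗ LinearMap.lTensor C1 (Coalgebra.counit (R := k) (A := C2))) ∧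
  ((TensorProduct.assoc k C2 C2 C1).toLinearMap
      ∘ₗ LinearMap.rTensor C1 (Coalgebra.comul (R := k) (A := C2)) ∘ₗ c
    = LinearMap.lTensor C2 c
      ∘ₗ (TensorProduct.assoc k C2 C1 C2).toLinearMap
      ∘ₗ LinearMap.rTensor C2 c
      ∘ₗ (TensorProduct.assoc k C1 C2 C2).symm.toLinearMap
      ∘ₗ LinearMap.lTensor C1 (Coalgebra.comul (R := k) (A := C2)))

/-- The comultiplication `Δ_{C1⊗_cC2} := (id_{C1}⊗c⊗id_{C2})∘(Δ₁⊗Δ₂)` on `C1⊗C2`. -/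
noncomputable def comulD (c : C1 ⊗[k] C2 →ₗ[k] C2 ⊗[k] C1) :
    (C1 ⊗[k] C2) →ₗ[k] (C1 ⊗[k] C2) ⊗[k] (C1 ⊗[k] C2) :=
  (TensorProduct.assoc k C1 C2 (C1 ⊗[k] C2)).symm.toLinearMap
    ∘ₗ LinearMap.lTensor C1 (TensorProduct.assoc k C2 C1 C2).toLinearMap
    ∘ₗ LinearMap.lTensor C1 (LinearMap.rTensor C2 c)
    ∘ₗ LinearMap.lTensor C1 (TensorProduct.assoc k C1 C2 C2).symm.toLinearMap
    ∘ₗ (TensorProduct.assoc k C1 C1 (C2 ⊗[k] C2)).toLinearMap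
    ∘ₗ TensorProduct.map (Coalgebra.comul (R := k) (A := C1))
        (Coalgebra.comul (R := k) (A := C2))

/-- The counit `ε₁⊗ε₂` on `C1⊗C2`. -/
noncomputable def counitD : (C1 ⊗[k] C2) →ₗ[k] k :=
  (TensorProduct.lid k k).toLinearMap
    ∘ₗ TensorProduct.map (Coalgebra.counit (R := k) (A := C1))
        (Coalgebra.counit (R := k) (A := C2))

/-- The inner part `id⊗c⊗id` of the comultiplication `comulD c`. -/
noncomputable def braidMiddle (c : C1 ⊗[k] C2 →ₗ[k] C2 ⊗[k] C1) :
    (C1 ⊗[k] C1) ⊗[k] (C2 ⊗[k] C2) →ₗ[k] (C1 ⊗[k] C2) ⊗[k] (C1 ⊗[k] C2) :=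
  (TensorProduct.assoc k C1 C2 (C1 ⊗[k] C2)).symm.toLinearMap
    ∘ₗ LinearMap.lTensor C1 (TensorProduct.assoc k C2 C1 C2).toLinearMap
    ∘ₗ LinearMap.lTensor C1 (LinearMap.rTensor C2 c)
    ∘ₗ LinearMap.lTensor C1 (TensorProduct.assoc k C1 C2 C2).symm.toLinearMap
    ∘ₗ (TensorProduct.assoc k C1 C1 (C2 ⊗[k] C2)).toLinearMap

lemma comulD_tmul (c : C1 ⊗[k] C2 →ₗ[k] C2 ⊗[k] C1) (x : C1) (y : C2) :
    comulD c (x ⊗ₜ y) =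
      braidMiddle c (Coalgebra.comul (R := k) x ⊗ₜ Coalgebra.comul (R := k) y) := rfl

set_option linter.unusedSectionVars false in
lemma braidMiddle_tmul (c : C1 ⊗[k] C2 →ₗ[k] C2 ⊗[k] C1) (a b : C1) (p q : C2) :
    braidMiddle c ((a ⊗ₜ b) ⊗ₜ (p ⊗ₜ q)) =
      (TensorProduct.assoc k C1 C2 (C1 ⊗[k] C2)).symm
        (a ⊗ₜ TensorProduct.assoc k C2 C1 C2 (c (b ⊗ₜ p) ⊗ₜ q)) := rfl

/-- The rebracketing `a⊗((p⊗q)⊗((r⊗s)⊗g)) ↦ (a⊗p)⊗((q⊗r)⊗(s⊗g))`. -/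
noncomputable def regroup :
    C1 ⊗[k] ((C2 ⊗[k] C1) ⊗[k] ((C2 ⊗[k] C1) ⊗[k] C2)) →ₗ[k]
      (C1 ⊗[k] C2) ⊗[k] ((C1 ⊗[k] C2) ⊗[k] (C1 ⊗[k] C2)) :=
  LinearMap.lTensor (C1 ⊗[k] C2) (TensorProduct.assoc k C1 C2 (C1 ⊗[k] C2)).symm.toLinearMap
    ∘ₗ (TensorProduct.assoc k C1 C2 (C1 ⊗[k] (C2 ⊗[k] (C1 ⊗[k] C2)))).symm.toLinearMap
    ∘ₗ LinearMap.lTensor C1 (TensorProduct.assoc k C2 C1 (C2 ⊗[k] (C1 ⊗[k] C2))).toLinearMap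
    ∘ₗ LinearMap.lTensor C1
        (LinearMap.lTensor (C2 ⊗[k] C1) (TensorProduct.assoc k C2 C1 C2).toLinearMap)

/-- The map `(a⊗b⊗d)⊗(e⊗f⊗g) ↦ a⊗c(b⊗p)⊗c(q⊗f)⊗g`, where `p⊗q` stands for `c(d⊗e)`. -/
noncomputable def tripleBraid (c : C1 ⊗[k] C2 →ₗ[k] C2 ⊗[k] C1) :
    (C1 ⊗[k] (C1 ⊗[k] C1)) ⊗[k] (C2 ⊗[k] (C2 ⊗[k] C2)) →ₗ[k]
      (C1 ⊗[k] C2) ⊗[k] ((C1 ⊗[k] C2) ⊗[k] (C1 ⊗[k] C2)) :=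
  regroup
    ∘ₗ LinearMap.lTensor C1 (TensorProduct.map c (LinearMap.rTensor C2 c)
      ∘ₗ LinearMap.lTensor (C1 ⊗[k] C2) (TensorProduct.assoc k C1 C2 C2).symm.toLinearMap
      ∘ₗ (TensorProduct.assoc k C1 C2 (C1 ⊗[k] (C2 ⊗[k] C2))).symm.toLinearMap
      ∘ₗ LinearMap.lTensor C1 ((TensorProduct.assoc k C2 C1 (C2 ⊗[k] C2)).toLinearMap
        ∘ₗ LinearMap.rTensor (C2 ⊗[k] C2) c
        ∘ₗ (TensorProduct.assoc k C1 C2 (C2 ⊗[k] C2)).symm.toLinearMap)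
      ∘ₗ (TensorProduct.assoc k C1 C1 (C2 ⊗[k] (C2 ⊗[k] C2))).toLinearMap)
    ∘ₗ (TensorProduct.assoc k C1 (C1 ⊗[k] C1) (C2 ⊗[k] (C2 ⊗[k] C2))).toLinearMap

/-- The map `(a⊗b)⊗((p⊗(r⊗s))⊗g) ↦ a⊗c(b⊗p)⊗r⊗s⊗g`. -/
noncomputable def leftBraid (c : C1 ⊗[k] C2 →ₗ[k] C2 ⊗[k] C1) :
    (C1 ⊗[k] C1) ⊗[k] ((C2 ⊗[k] (C2 ⊗[k] C1)) ⊗[k] C2) →ₗ[k]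
      (C1 ⊗[k] C2) ⊗[k] ((C1 ⊗[k] C2) ⊗[k] (C1 ⊗[k] C2)) :=
  regroup
    ∘ₗ LinearMap.lTensor C1 (LinearMap.rTensor ((C2 ⊗[k] C1) ⊗[k] C2) c
      ∘ₗ (TensorProduct.assoc k C1 C2 ((C2 ⊗[k] C1) ⊗[k] C2)).symm.toLinearMap
      ∘ₗ LinearMap.lTensor C1 (TensorProduct.assoc k C2 (C2 ⊗[k] C1) C2).toLinearMap)
    ∘ₗ (TensorProduct.assoc k C1 C1 ((C2 ⊗[k] (C2 ⊗[k] C1)) ⊗[k] C2)).toLinearMap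

/-- The map `a⊗((p⊗(q⊗r))⊗(f⊗g)) ↦ a⊗p⊗q⊗c(r⊗f)⊗g`. -/
noncomputable def rightBraid (c : C1 ⊗[k] C2 →ₗ[k] C2 ⊗[k] C1) :
    C1 ⊗[k] ((C2 ⊗[k] (C1 ⊗[k] C1)) ⊗[k] (C2 ⊗[k] C2)) →ₗ[k]
      (C1 ⊗[k] C2) ⊗[k] ((C1 ⊗[k] C2) ⊗[k] (C1 ⊗[k] C2)) :=
  LinearMap.lTensor (C1 ⊗[k] C2) (braidMiddle c)
    ∘ₗ (TensorProduct.assoc k C1 C2 ((C1 ⊗[k] C1) ⊗[k] (C2 ⊗[k] C2))).symm.toLinearMap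
    ∘ₗ LinearMap.lTensor C1
        (TensorProduct.assoc k C2 (C1 ⊗[k] C1) (C2 ⊗[k] C2)).toLinearMap

lemma rTensor_comulD_eq_leftBraid (c : C1 ⊗[k] C2 →ₗ[k] C2 ⊗[k] C1)
    (x : C1) (w : C2 ⊗[k] C1) (b : C2) :
    TensorProduct.assoc k (C1 ⊗[k] C2) (C1 ⊗[k] C2) (C1 ⊗[k] C2)
      (LinearMap.rTensor (C1 ⊗[k] C2) (comulD c)
        ((TensorProduct.assoc k C1 C2 (C1 ⊗[k] C2)).symm
          (x ⊗ₜ TensorProduct.assoc k C2 C1 C2 (w ⊗ₜ b)))) =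
    leftBraid c (Coalgebra.comul (R := k) x ⊗ₜ
      (TensorProduct.assoc k C2 C2 C1
        (LinearMap.rTensor C1 (Coalgebra.comul (R := k) (A := C2)) w) ⊗ₜ b)) := by
  induction w with
  | zero => simp only [TensorProduct.zero_tmul, TensorProduct.tmul_zero, map_zero]
  | add w w' h h' => simp only [TensorProduct.add_tmul, TensorProduct.tmul_add, map_add, h, h']
  | tmul p q =>
  simp only [TensorProduct.assoc_tmul, TensorProduct.assoc_symm_tmul, LinearMap.rTensor_tmul,
    comulD_tmul]
  generalize (Coalgebra.comul (R := k) x) = a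
  generalize (Coalgebra.comul (R := k) p) = e
  induction a with
  | zero => simp only [TensorProduct.zero_tmul, map_zero]
  | add w w' h h' => simp only [TensorProduct.add_tmul, map_add, h, h']
  | tmul a₁ a₂ =>
  induction e with
  | zero => simp only [TensorProduct.zero_tmul, TensorProduct.tmul_zero, map_zero]
  | add w w' h h' => simp only [TensorProduct.add_tmul, TensorProduct.tmul_add, map_add, h, h']
  | tmul p₁ p₂ =>
  simp only [braidMiddle_tmul, leftBraid, LinearMap.comp_apply, LinearEquiv.coe_coe,
    TensorProduct.assoc_tmul, TensorProduct.assoc_symm_tmul, LinearMap.rTensor_tmul,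
    LinearMap.lTensor_tmul]
  generalize c (a₂ ⊗ₜ p₁) = z
  induction z with
  | zero => simp only [TensorProduct.zero_tmul, TensorProduct.tmul_zero, map_zero]
  | add w w' h h' => simp only [TensorProduct.add_tmul, TensorProduct.tmul_add, map_add, h, h']
  | tmul r s => rfl

set_option linter.unusedSectionVars false in
lemma leftBraid_eq_tripleBraid (c : C1 ⊗[k] C2 →ₗ[k] C2 ⊗[k] C1)
    (a : C1 ⊗[k] C1) (x : C1) (e : C2 ⊗[k] C2) (b : C2) :
    leftBraid c (a ⊗ₜ (LinearMap.lTensor C2 c (TensorProduct.assoc k C2 C1 C2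
      (LinearMap.rTensor C2 c ((TensorProduct.assoc k C1 C2 C2).symm (x ⊗ₜ e)))) ⊗ₜ b)) =
    tripleBraid c (TensorProduct.assoc k C1 C1 C1 (a ⊗ₜ x) ⊗ₜ
      TensorProduct.assoc k C2 C2 C2 (e ⊗ₜ b)) := by
  induction a with
  | zero => simp only [TensorProduct.zero_tmul, map_zero]
  | add w w' h h' => simp only [TensorProduct.add_tmul, map_add, h, h']
  | tmul a₁ a₂ =>
  induction e with
  | zero => simp only [TensorProduct.zero_tmul, TensorProduct.tmul_zero, map_zero]
  | add w w' h h' => simp only [TensorProduct.add_tmul, TensorProduct.tmul_add, map_add, h, h']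
  | tmul e₁ e₂ =>
  simp only [tripleBraid, leftBraid, LinearMap.comp_apply, LinearEquiv.coe_coe,
    TensorProduct.assoc_tmul, TensorProduct.assoc_symm_tmul, LinearMap.rTensor_tmul,
    LinearMap.lTensor_tmul]
  generalize c (x ⊗ₜ e₁) = z
  induction z with
  | zero => simp only [TensorProduct.zero_tmul, TensorProduct.tmul_zero, map_zero]
  | add w w' h h' => simp only [TensorProduct.add_tmul, TensorProduct.tmul_add, map_add, h, h']
  | tmul r s => rfl

lemma lTensor_comulD_eq_rightBraid (c : C1 ⊗[k] C2 →ₗ[k] C2 ⊗[k] C1)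
    (x : C1) (w : C2 ⊗[k] C1) (b : C2) :
    LinearMap.lTensor (C1 ⊗[k] C2) (comulD c)
      ((TensorProduct.assoc k C1 C2 (C1 ⊗[k] C2)).symm
        (x ⊗ₜ TensorProduct.assoc k C2 C1 C2 (w ⊗ₜ b))) =
    rightBraid c (x ⊗ₜ
      (LinearMap.lTensor C2 (Coalgebra.comul (R := k) (A := C1)) w ⊗ₜ
        Coalgebra.comul (R := k) b)) := by
  induction w with
  | zero => simp only [TensorProduct.zero_tmul, TensorProduct.tmul_zero, map_zero]
  | add w w' h h' => simp only [TensorProduct.add_tmul, TensorProduct.tmul_add, map_add, h, h']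
  | tmul p q => rfl

set_option linter.unusedSectionVars false in
lemma rightBraid_eq_tripleBraid (c : C1 ⊗[k] C2 →ₗ[k] C2 ⊗[k] C1)
    (x : C1) (a : C1 ⊗[k] C1) (y : C2) (e : C2 ⊗[k] C2) :
    rightBraid c (x ⊗ₜ (TensorProduct.assoc k C2 C1 C1 (LinearMap.rTensor C1 c
      ((TensorProduct.assoc k C1 C2 C1).symm (LinearMap.lTensor C1 c
        (TensorProduct.assoc k C1 C1 C2 (a ⊗ₜ y))))) ⊗ₜ e)) =
    tripleBraid c ((x ⊗ₜ a) ⊗ₜ (y ⊗ₜ e)) := by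
  induction a with
  | zero => simp only [TensorProduct.zero_tmul, TensorProduct.tmul_zero, map_zero]
  | add w w' h h' => simp only [TensorProduct.add_tmul, TensorProduct.tmul_add, map_add, h, h']
  | tmul a₁ a₂ =>
  induction e with
  | zero => simp only [TensorProduct.tmul_zero, map_zero]
  | add w w' h h' => simp only [TensorProduct.tmul_add, map_add, h, h']
  | tmul e₁ e₂ =>
  simp only [tripleBraid, rightBraid, LinearMap.comp_apply, LinearEquiv.coe_coe,
    TensorProduct.assoc_tmul, TensorProduct.assoc_symm_tmul, LinearMap.rTensor_tmul,
    LinearMap.lTensor_tmul]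
  generalize c (a₂ ⊗ₜ y) = z
  induction z with
  | zero => simp only [TensorProduct.zero_tmul, TensorProduct.tmul_zero, map_zero]
  | add w w' h h' => simp only [TensorProduct.add_tmul, TensorProduct.tmul_add, map_add, h, h']
  | tmul p q =>
  simp only [TensorProduct.assoc_tmul, TensorProduct.assoc_symm_tmul, LinearMap.rTensor_tmul,
    LinearMap.lTensor_tmul, TensorProduct.map_tmul, LinearEquiv.coe_coe]
  generalize c (a₁ ⊗ₜ p) = z
  induction z with
  | zero => simp only [TensorProduct.zero_tmul, TensorProduct.tmul_zero, map_zero]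
  | add w w' h h' => simp only [TensorProduct.add_tmul, TensorProduct.tmul_add, map_add, h, h']
  | tmul r s =>
  simp only [TensorProduct.assoc_tmul, TensorProduct.assoc_symm_tmul, LinearMap.lTensor_tmul,
    braidMiddle_tmul]
  generalize c (q ⊗ₜ e₁) = z
  induction z with
  | zero => simp only [TensorProduct.zero_tmul, TensorProduct.tmul_zero, map_zero]
  | add w w' h h' => simp only [TensorProduct.add_tmul, TensorProduct.tmul_add, map_add, h, h']
  | tmul t u => rfl

lemma rTensor_comulD_braidMiddle {c : C1 ⊗[k] C2 →ₗ[k] C2 ⊗[k] C1} (h : CompatSecond c)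
    (x : C1 ⊗[k] C1) (y : C2 ⊗[k] C2) :
    TensorProduct.assoc k (C1 ⊗[k] C2) (C1 ⊗[k] C2) (C1 ⊗[k] C2)
      (LinearMap.rTensor (C1 ⊗[k] C2) (comulD c) (braidMiddle c (x ⊗ₜ y))) =
    tripleBraid c
      (TensorProduct.assoc k C1 C1 C1 (LinearMap.rTensor C1 (Coalgebra.comul (R := k)) x) ⊗ₜ
        TensorProduct.assoc k C2 C2 C2 (LinearMap.rTensor C2 (Coalgebra.comul (R := k)) y)) := by
  induction x with
  | zero => simp only [TensorProduct.zero_tmul, map_zero]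
  | add w w' h h' => simp only [TensorProduct.add_tmul, map_add, h, h']
  | tmul x₁ x₂ =>
  induction y with
  | zero => simp only [TensorProduct.tmul_zero, map_zero]
  | add w w' h h' => simp only [TensorProduct.tmul_add, map_add, h, h']
  | tmul y₁ y₂ =>
  have hc := LinearMap.congr_fun h.2 (x₂ ⊗ₜ y₁)
  simp only [LinearMap.comp_apply, LinearEquiv.coe_coe, LinearMap.lTensor_tmul C1] at hc
  rw [braidMiddle_tmul, rTensor_comulD_eq_leftBraid, hc, leftBraid_eq_tripleBraid]
  rfl

lemma lTensor_comulD_braidMiddle {c : C1 ⊗[k] C2 →ₗ[k] C2 ⊗[k] C1} (h : CompatFirst c)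
    (x : C1 ⊗[k] C1) (y : C2 ⊗[k] C2) :
    LinearMap.lTensor (C1 ⊗[k] C2) (comulD c) (braidMiddle c (x ⊗ₜ y)) =
    tripleBraid c (LinearMap.lTensor C1 (Coalgebra.comul (R := k)) x ⊗ₜ
      LinearMap.lTensor C2 (Coalgebra.comul (R := k)) y) := by
  induction x with
  | zero => simp only [TensorProduct.zero_tmul, map_zero]
  | add w w' h h' => simp only [TensorProduct.add_tmul, map_add, h, h']
  | tmul x₁ x₂ =>
  induction y with
  | zero => simp only [TensorProduct.tmul_zero, map_zero]
  | add w w' h h' => simp only [TensorProduct.tmul_add, map_add, h, h']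
  | tmul y₁ y₂ =>
  have hc := LinearMap.congr_fun h.2 (x₂ ⊗ₜ y₁)
  simp only [LinearMap.comp_apply, LinearEquiv.coe_coe, LinearMap.rTensor_tmul C2] at hc
  rw [braidMiddle_tmul, lTensor_comulD_eq_rightBraid, hc, rightBraid_eq_tripleBraid]
  rfl

lemma rTensor_counitD_braidMiddle {c : C1 ⊗[k] C2 →ₗ[k] C2 ⊗[k] C1} (h : CompatSecond c)
    (x : C1 ⊗[k] C1) (y : C2 ⊗[k] C2) :
    TensorProduct.lid k (C1 ⊗[k] C2)
      (LinearMap.rTensor (C1 ⊗[k] C2) counitD (braidMiddle c (x ⊗ₜ y))) =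
    TensorProduct.lid k C1 (LinearMap.rTensor C1 (Coalgebra.counit (R := k)) x) ⊗ₜ
      TensorProduct.lid k C2 (LinearMap.rTensor C2 (Coalgebra.counit (R := k)) y) := by
  induction x with
  | zero => simp only [TensorProduct.zero_tmul, map_zero]
  | add w w' h h' => simp only [TensorProduct.add_tmul, map_add, h, h']
  | tmul x₁ x₂ =>
  induction y with
  | zero => simp only [TensorProduct.tmul_zero, map_zero]
  | add w w' h h' => simp only [TensorProduct.tmul_add, map_add, h, h']
  | tmul y₁ y₂ =>
  have key (w : C2 ⊗[k] C1) : TensorProduct.lid k (C1 ⊗[k] C2)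
      (LinearMap.rTensor (C1 ⊗[k] C2) counitD
        ((TensorProduct.assoc k C1 C2 (C1 ⊗[k] C2)).symm
          (x₁ ⊗ₜ TensorProduct.assoc k C2 C1 C2 (w ⊗ₜ y₂)))) =
      Coalgebra.counit (R := k) x₁ • (TensorProduct.lid k C1
        (LinearMap.rTensor C1 (Coalgebra.counit (R := k)) w) ⊗ₜ y₂) := by
    induction w with
    | zero => simp only [TensorProduct.zero_tmul, TensorProduct.tmul_zero, map_zero, smul_zero]
    | add w w' h h' =>
      simp only [TensorProduct.add_tmul, TensorProduct.tmul_add, map_add, smul_add, h, h']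
    | tmul p q => simp [counitD, TensorProduct.smul_tmul', mul_smul]
  have hc := LinearMap.congr_fun h.1 (x₂ ⊗ₜ y₁)
  simp only [LinearMap.comp_apply, LinearEquiv.coe_coe] at hc
  rw [braidMiddle_tmul, key, hc]
  simp only [TensorProduct.lid_tmul, TensorProduct.rid_tmul, LinearMap.rTensor_tmul,
    LinearMap.lTensor_tmul, ← TensorProduct.smul_tmul', TensorProduct.tmul_smul, smul_smul,
    mul_comm]

lemma lTensor_counitD_braidMiddle {c : C1 ⊗[k] C2 →ₗ[k] C2 ⊗[k] C1} (h : CompatFirst c)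
    (x : C1 ⊗[k] C1) (y : C2 ⊗[k] C2) :
    TensorProduct.rid k (C1 ⊗[k] C2)
      (LinearMap.lTensor (C1 ⊗[k] C2) counitD (braidMiddle c (x ⊗ₜ y))) =
    TensorProduct.rid k C1 (LinearMap.lTensor C1 (Coalgebra.counit (R := k)) x) ⊗ₜ
      TensorProduct.rid k C2 (LinearMap.lTensor C2 (Coalgebra.counit (R := k)) y) := by
  induction x with
  | zero => simp only [TensorProduct.zero_tmul, map_zero]
  | add w w' h h' => simp only [TensorProduct.add_tmul, map_add, h, h']
  | tmul x₁ x₂ =>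
  induction y with
  | zero => simp only [TensorProduct.tmul_zero, map_zero]
  | add w w' h h' => simp only [TensorProduct.tmul_add, map_add, h, h']
  | tmul y₁ y₂ =>
  have key (w : C2 ⊗[k] C1) : TensorProduct.rid k (C1 ⊗[k] C2)
      (LinearMap.lTensor (C1 ⊗[k] C2) counitD
        ((TensorProduct.assoc k C1 C2 (C1 ⊗[k] C2)).symm
          (x₁ ⊗ₜ TensorProduct.assoc k C2 C1 C2 (w ⊗ₜ y₂)))) =
      Coalgebra.counit (R := k) y₂ • (x₁ ⊗ₜ TensorProduct.rid k C2
        (LinearMap.lTensor C2 (Coalgebra.counit (R := k)) w)) := by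
    induction w with
    | zero => simp only [TensorProduct.zero_tmul, TensorProduct.tmul_zero, map_zero, smul_zero]
    | add w w' h h' =>
      simp only [TensorProduct.add_tmul, TensorProduct.tmul_add, map_add, smul_add, h, h']
    | tmul p q => simp [counitD, TensorProduct.tmul_smul, smul_smul, mul_comm]
  have hc := LinearMap.congr_fun h.1 (x₂ ⊗ₜ y₁)
  simp only [LinearMap.comp_apply, LinearEquiv.coe_coe] at hc
  rw [braidMiddle_tmul, key, hc]
  simp only [TensorProduct.lid_tmul, TensorProduct.rid_tmul, LinearMap.rTensor_tmul,
    LinearMap.lTensor_tmul, ← TensorProduct.smul_tmul', TensorProduct.tmul_smul, smul_smul,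
    mul_comm]

/-- `C1⊗C2` endowed with the comultiplication `(id⊗c⊗id)∘(Δ₁⊗Δ₂)` and counit `ε₁⊗ε₂`
is a coassociative counital `k`-coalgebra. -/
theorem braidedTensorCoalgebra (c : C1 ⊗[k] C2 →ₗ[k] C2 ⊗[k] C1)
    (h1 : CompatFirst c) (h2 : CompatSecond c) :
    ((TensorProduct.assoc k (C1 ⊗[k] C2) (C1 ⊗[k] C2) (C1 ⊗[k] C2)).toLinearMap
        ∘ₗ LinearMap.rTensor (C1 ⊗[k] C2) (comulD c) ∘ₗ comulD c
      = LinearMap.lTensor (C1 ⊗[k] C2) (comulD c) ∘ₗ comulD c) ∧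
    ((TensorProduct.lid k (C1 ⊗[k] C2)).toLinearMap
        ∘ₗ LinearMap.rTensor (C1 ⊗[k] C2) counitD ∘ₗ comulD c
      = (LinearMap.id : C1 ⊗[k] C2 →ₗ[k] C1 ⊗[k] C2)) ∧
    ((TensorProduct.rid k (C1 ⊗[k] C2)).toLinearMap
        ∘ₗ LinearMap.lTensor (C1 ⊗[k] C2) counitD ∘ₗ comulD c
      = (LinearMap.id : C1 ⊗[k] C2 →ₗ[k] C1 ⊗[k] C2)) := by
  refine ⟨TensorProduct.ext' fun x y => ?_, TensorProduct.ext' fun x y => ?_,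
    TensorProduct.ext' fun x y => ?_⟩
  · simp only [LinearMap.comp_apply, LinearEquiv.coe_coe, comulD_tmul]
    rw [rTensor_comulD_braidMiddle h2, lTensor_comulD_braidMiddle h1,
      Coalgebra.coassoc_apply, Coalgebra.coassoc_apply]
  · simp only [LinearMap.comp_apply, LinearEquiv.coe_coe, comulD_tmul]
    rw [rTensor_counitD_braidMiddle h2]
    simp
  · simp only [LinearMap.comp_apply, LinearEquiv.coe_coe, comulD_tmul]
    rw [lTensor_counitD_braidMiddle h1]
    simp
end
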